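/- arXiv:1802.08097 — 2 statements merged into one kernel-verified Lean document; each statement's English description precedes it below -/
import Mathlib

section
/- If 1 ≤ k ≤ n and gcd(k,n) = 1, then o(λ) = n for every λ ∈ Y_{k,n}, i.e. every orbit of the cyclic action on Y_{k,n} is free. -/
/-- A Young diagram inscribed in a `k × (n-k)` rectangle: a weakly decreasing
sequence `λ₁ ≥ … ≥ λ_k` (0-indexed) with all entries `≤ n - k`. -/
def IsDiagram (k n : ℕ) (lam : Fin k → ℕ) : Prop :=
  (∀ i j : Fin k, i ≤ j → lam j ≤ lam i) ∧ ∀ i, lam i ≤ n - k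

/-- The cyclic step map `σ` on diagrams: add one box to every row if the first
row is shorter than `n - k`, otherwise drop the first row and append a zero row. -/
def cyc (k n : ℕ) (lam : Fin k → ℕ) : Fin k → ℕ :=
  if ∀ i, lam i < n - k then fun i => lam i + 1
  else fun i => if h : (i : ℕ) + 1 < k then lam ⟨(i : ℕ) + 1, h⟩ else 0

/-- The orbit length `o(λ)`: the least positive `t` with `σ^[t] λ = λ`. -/
noncomputable def orbLen (k n : ℕ) (lam : Fin k → ℕ) : ℕ :=
  sInf {t | 0 < t ∧ (cyc k n)^[t] lam = lam}

/-- Upper triangular diagram: `k·λᵢ ≤ (n-k)(k-i)` for all `i` (1-indexed). -/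
def IsUpper (k n : ℕ) (lam : Fin k → ℕ) : Prop :=
  ∀ i : Fin k, k * lam i ≤ (n - k) * (k - 1 - (i : ℕ))

/-- Lexicographic (non-strict) comparison of diagrams. -/
def lexLE {k : ℕ} (lam mu : Fin k → ℕ) : Prop :=
  lam = mu ∨ ∃ t : Fin k, (∀ i, i < t → lam i = mu i) ∧ lam t < mu t

/-- Minimal upper triangular diagram: upper triangular and lexicographically
smallest among the upper triangular diagrams in its `σ`-orbit. -/
def IsMinUpper (k n : ℕ) (lam : Fin k → ℕ) : Prop :=
  IsUpper k n lam ∧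
    ∀ t : ℕ, IsUpper k n ((cyc k n)^[t] lam) → lexLE lam ((cyc k n)^[t] lam)

/-- The binary word of a diagram: position `j` (0-indexed) carries the symbol `0`
(encoded as `false`) iff `j = λ_{k-i} + i` for some `0 ≤ i ≤ k-1` (0-indexed). -/
def word (k n : ℕ) (lam : Fin k → ℕ) (j : Fin n) : Bool :=
  !decide (∃ i : Fin k, (j : ℕ) = lam i.rev + (i : ℕ))

/-- A binary word of length `n` with exactly `k` zeros (`false` encodes `0`). -/
def IsWord (k n : ℕ) (w : Fin n → Bool) : Prop :=
  (Finset.univ.filter fun j => w j = false).card = k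

/-- Rotation of a binary word: `r(w)_j = w_{j+1}`, indices mod `n`. -/
def rot {n : ℕ} (w : Fin n → Bool) (j : Fin n) : Bool :=
  w ⟨((j : ℕ) + 1) % n, Nat.mod_lt _ j.pos⟩

/-- The diagram `θ_{k,km} = ((k-1)(m-1), (k-2)(m-1), …, (m-1), 0)`. -/
def theta (k m : ℕ) : Fin k → ℕ := fun i => (k - 1 - (i : ℕ)) * (m - 1)

/-- `N_{k,n}`: the number of diagrams in `Y_{k,n}` with full orbit `o(λ) = n`. -/
noncomputable def NN (k n : ℕ) : ℕ :=
  {lam : Fin k → ℕ | IsDiagram k n lam ∧ orbLen k n lam = n}.ncard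

theorem IsDiagram.eq_of_not_forall_lt {k n : ℕ} (hk : 0 < k) {lam : Fin k → ℕ}
    (h : IsDiagram k n lam) (hc : ¬ ∀ i, lam i < n - k) : lam ⟨0, hk⟩ = n - k := by
  push Not at hc
  obtain ⟨i, hi⟩ := hc
  exact le_antisymm (h.2 _) (hi.trans (h.1 _ i (Nat.zero_le _)))

theorem IsDiagram.isDiagram_cyc {k n : ℕ} {lam : Fin k → ℕ} (h : IsDiagram k n lam) :
    IsDiagram k n (cyc k n lam) := by
  unfold cyc
  split_ifs with hc
  · exact ⟨fun i j hij => Nat.succ_le_succ (h.1 i j hij), hc⟩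
  · refine ⟨fun i j hij => ?_, fun i => ?_⟩
    · have hij' : (i : ℕ) ≤ j := hij
      dsimp only
      split_ifs with h1 h2
      · exact h.1 _ _ (Nat.succ_le_succ hij')
      · omega
      · exact Nat.zero_le _
      · exact le_rfl
    · dsimp only
      split_ifs
      · exact h.2 _
      · exact Nat.zero_le _

theorem IsDiagram.iterate_cyc {k n : ℕ} {lam : Fin k → ℕ} (h : IsDiagram k n lam) (t : ℕ) :
    IsDiagram k n ((cyc k n)^[t] lam) := by
  induction t with
  | zero => exact h
  | succ t ih => rw [Function.iterate_succ_apply']; exact ih.isDiagram_cyc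

/-- The number of boxes changes by `k` modulo `n` under the cyclic step. -/
theorem IsDiagram.sum_cyc_modEq {k n : ℕ} (hk : 0 < k) (hkn : k ≤ n) {lam : Fin k → ℕ}
    (h : IsDiagram k n lam) : ∑ i, cyc k n lam i ≡ ∑ i, lam i + k [MOD n] := by
  by_cases hc : ∀ i, lam i < n - k
  · simp [cyc, if_pos hc, Finset.sum_add_distrib, Nat.ModEq.refl]
  · have h0 := h.eq_of_not_forall_lt hk hc
    obtain ⟨m, rfl⟩ := Nat.exists_eq_succ_of_ne_zero hk.ne'
    have hsum : ∑ i, lam i + (m + 1) = ∑ i, cyc (m + 1) n lam i + n := by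
      simp only [cyc, if_neg hc]
      rw [Fin.sum_univ_succ, Fin.sum_univ_castSucc]
      have h0' : lam 0 = n - (m + 1) := h0
      have hs : ∀ i : Fin m, (if h : ((Fin.castSucc i : Fin (m + 1)) : ℕ) + 1 < m + 1 then
          lam ⟨(Fin.castSucc i : Fin (m + 1)) + 1, h⟩ else 0) = lam i.succ := fun i =>
        dif_pos (Nat.succ_lt_succ i.isLt)
      rw [Finset.sum_congr rfl fun i _ => hs i, dif_neg (by simp), h0']
      omega
    change _ ≡ ∑ i, lam i + (m + 1) [MOD n]
    rw [hsum]
    simp [Nat.ModEq]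

theorem IsDiagram.sum_iterate_cyc_modEq {k n : ℕ} (hk : 0 < k) (hkn : k ≤ n) {lam : Fin k → ℕ}
    (h : IsDiagram k n lam) (t : ℕ) :
    ∑ i, (cyc k n)^[t] lam i ≡ ∑ i, lam i + k * t [MOD n] := by
  induction t with
  | zero => exact Nat.ModEq.refl _
  | succ t ih =>
    rw [Function.iterate_succ_apply', mul_add_one, ← add_assoc]
    exact ((h.iterate_cyc t).sum_cyc_modEq hk hkn).trans (ih.add_right k)

/-- The quasi-periodic extension of a diagram to all row indices, with
`λ_{i+k} = λ_i - (n-k)`. -/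
def extendRows (k n : ℕ) (hk : 0 < k) (lam : Fin k → ℕ) (m : ℕ) : ℤ :=
  (lam ⟨m % k, Nat.mod_lt m hk⟩ : ℤ) - (m / k : ℕ) * (n - k : ℕ)

theorem extendRows_of_lt {k n : ℕ} (hk : 0 < k) (lam : Fin k → ℕ) {m : ℕ} (hm : m < k) :
    extendRows k n hk lam m = lam ⟨m, hm⟩ := by
  simp [extendRows, Nat.mod_eq_of_lt hm, Nat.div_eq_of_lt hm]

theorem extendRows_add_self {k n : ℕ} (hk : 0 < k) (lam : Fin k → ℕ) (m : ℕ) :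
    extendRows k n hk lam (m + k) = extendRows k n hk lam m - (n - k : ℕ) := by
  simp only [extendRows, Nat.add_mod_right, Nat.add_div_right m hk]
  push_cast
  ring

theorem IsDiagram.extendRows_le {k n : ℕ} (hk : 0 < k) {lam : Fin k → ℕ}
    (h : IsDiagram k n lam) (m : ℕ) : extendRows k n hk lam m ≤ (n - k : ℕ) := by
  have h1 : (lam ⟨m % k, Nat.mod_lt m hk⟩ : ℤ) ≤ (n - k : ℕ) := by exact_mod_cast h.2 _
  have h2 : (0 : ℤ) ≤ (m / k : ℕ) * (n - k : ℕ) := by positivity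
  unfold extendRows
  linarith

/-- Iterates of the cyclic step are shifted windows of the extended diagram. -/
theorem IsDiagram.exists_iterate_cyc_eq {k n : ℕ} (hk : 0 < k) {lam : Fin k → ℕ}
    (h : IsDiagram k n lam) (t : ℕ) :
    ∃ j : ℕ, ∀ i : Fin k,
      ((cyc k n)^[t] lam i : ℤ) = extendRows k n hk lam (i + j) + t - j := by
  induction t with
  | zero => exact ⟨0, fun i => by simp [extendRows_of_lt hk lam i.isLt]⟩
  | succ t ih =>
    obtain ⟨j, hj⟩ := ih
    have hd := h.iterate_cyc t
    rw [Function.iterate_succ_apply']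
    generalize (cyc k n)^[t] lam = mu at hj hd
    by_cases hc : ∀ i, mu i < n - k
    · refine ⟨j, fun i => ?_⟩
      simp only [cyc, if_pos hc]
      push_cast
      rw [hj i]
      ring
    · refine ⟨j + 1, fun i => ?_⟩
      simp only [cyc, if_neg hc]
      split_ifs with hi
      · rw [hj, show (i : ℕ) + 1 + j = i + (j + 1) by ring]
        push_cast
        ring
      · have h0 := hj ⟨0, hk⟩
        rw [hd.eq_of_not_forall_lt hk hc] at h0
        rw [show (i : ℕ) + (j + 1) = (0 + j) + k by omega, extendRows_add_self]
        push_cast at h0 ⊢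
        linarith

theorem IsDiagram.iterate_cyc_self {k n : ℕ} (hk : 0 < k) (hkn : k ≤ n) {lam : Fin k → ℕ}
    (h : IsDiagram k n lam) : (cyc k n)^[n] lam = lam := by
  obtain ⟨j, hj⟩ := h.exists_iterate_cyc_eq hk n
  have hd := h.iterate_cyc n
  generalize (cyc k n)^[n] lam = mu at hj hd
  obtain hlt | rfl | hgt := lt_trichotomy j k
  · have h0 := hj ⟨0, hk⟩
    have hle := hd.2 ⟨0, hk⟩
    rw [show ((⟨0, hk⟩ : Fin k) : ℕ) + j = j from Nat.zero_add j,
      extendRows_of_lt hk lam hlt] at h0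
    omega
  · funext i
    have hi := hj i
    rw [extendRows_add_self, extendRows_of_lt hk lam i.isLt] at hi
    simp only [Fin.eta] at hi
    omega
  · obtain ⟨m, rfl⟩ := Nat.exists_eq_add_of_lt hgt
    have hl := hj ⟨k - 1, by omega⟩
    have hm := h.extendRows_le hk m
    rw [show k - 1 + (k + m + 1) = m + k + k by omega, extendRows_add_self,
      extendRows_add_self] at hl
    omega

/-- if `gcd(k,n) = 1` then every orbit is free: `o(λ) = n` for all
`λ ∈ Y_{k,n}`. -/
theorem orbLen_eq_of_coprime (k n : ℕ) (hk : 1 ≤ k) (hkn : k ≤ n)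
    (hg : Nat.gcd k n = 1) (lam : Fin k → ℕ) (hlam : IsDiagram k n lam) :
    orbLen k n lam = n := by
  have hleast : IsLeast {t | 0 < t ∧ (cyc k n)^[t] lam = lam} n := by
    refine ⟨⟨by omega, hlam.iterate_cyc_self hk hkn⟩, ?_⟩
    rintro t ⟨ht, hfix⟩
    have hsum := hlam.sum_iterate_cyc_modEq hk hkn t
    rw [hfix] at hsum
    have hdvd : n ∣ k * t := by simpa using (Nat.modEq_iff_dvd' (Nat.le_add_right _ _)).1 hsum
    exact Nat.le_of_dvd ht ((Nat.Coprime.symm hg).dvd_of_dvd_mul_left hdvd)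
  exact hleast.csInf_eq
end

section
/- For all integers k ≥ 1, m ≥ 1 and n = km, the diagram θ_{k,km} is the unique upper triangular diagram in its σ-orbit; in particular θ_{k,km} is minimal upper triangular. -/
/-- Every column-shifted copy `θ + c` with `c + 1 < m` is sent by `σ` to `θ + (c + 1)`. -/
lemma cyc_theta_add_of_lt {k m c : ℕ} (hc : c + 1 < m) :
    cyc k (k * m) (fun i => theta k m i + c) = fun i => theta k m i + (c + 1) := by
  obtain ⟨p, rfl⟩ : ∃ p, m = p + 1 := ⟨m - 1, by omega⟩
  have hn : k * (p + 1) - k = k * p := by rw [Nat.mul_succ, Nat.add_sub_cancel]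
  have hlt : ∀ i : Fin k, theta k (p + 1) i + c < k * (p + 1) - k := fun i => by
    obtain ⟨q, rfl⟩ : ∃ q, k = q + 1 := ⟨k - 1, by have := i.pos; omega⟩
    have h : (q - i) * p ≤ q * p := Nat.mul_le_mul_right _ (Nat.sub_le _ _)
    rw [hn, Nat.succ_mul]
    simp only [theta, Nat.add_sub_cancel]
    omega
  simp only [cyc, if_pos hlt, add_assoc]

/-- The last column-shifted copy `θ + (m - 1)` is sent by `σ` back to `θ`. -/
lemma cyc_theta_add_pred {k m : ℕ} (hk : 1 ≤ k) (hm : 1 ≤ m) :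
    cyc k (k * m) (fun i => theta k m i + (m - 1)) = theta k m := by
  obtain ⟨p, rfl⟩ : ∃ p, m = p + 1 := ⟨m - 1, by omega⟩
  obtain ⟨q, rfl⟩ : ∃ q, k = q + 1 := ⟨k - 1, by omega⟩
  have hn : (q + 1) * (p + 1) - (q + 1) = (q + 1) * p := by
    rw [Nat.mul_succ, Nat.add_sub_cancel]
  have hnot : ¬ ∀ i : Fin (q + 1),
      theta (q + 1) (p + 1) i + (p + 1 - 1) < (q + 1) * (p + 1) - (q + 1) := fun h => by
    have h0 := h 0
    rw [hn] at h0
    simp [theta, Nat.succ_mul] at h0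
  simp only [cyc, if_neg hnot]
  funext i
  simp only [theta, Nat.add_sub_cancel]
  split_ifs with h
  · rw [← Nat.succ_mul]
    congr 1
    omega
  · have hi : q - (i : ℕ) = 0 := by omega
    simp [hi]

/-- The `σ`-orbit of `θ` consists of the column-shifted copies `θ + c` with `c < m`. -/
lemma iterate_cyc_theta {k m : ℕ} (hk : 1 ≤ k) (hm : 1 ≤ m) (t : ℕ) :
    ∃ c < m, (cyc k (k * m))^[t] (theta k m) = fun i => theta k m i + c := by
  induction t with
  | zero => exact ⟨0, hm, rfl⟩
  | succ t ih =>
    obtain ⟨c, hc, h⟩ := ih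
    rw [Function.iterate_succ_apply', h]
    rcases Nat.lt_or_ge (c + 1) m with hlt | hge
    · exact ⟨c + 1, hlt, cyc_theta_add_of_lt hlt⟩
    · obtain rfl : c = m - 1 := by omega
      exact ⟨0, hm, cyc_theta_add_pred hk hm⟩

lemma isUpper_theta (k m : ℕ) : IsUpper k (k * m) (theta k m) := fun i => by
  rw [theta, show k * m - k = k * (m - 1) by rw [Nat.mul_sub_one], mul_assoc,
    mul_comm (m - 1)]

/-- The last row of an upper triangular diagram is empty. -/
lemma IsUpper.last_eq_zero {k n : ℕ} {lam : Fin k → ℕ} (h : IsUpper k n lam) (hk : 1 ≤ k) :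
    lam ⟨k - 1, by omega⟩ = 0 := by
  have h1 := h ⟨k - 1, by omega⟩
  simp only [Nat.sub_self, Nat.mul_zero, Nat.le_zero, Nat.mul_eq_zero] at h1
  omega

/-- for `n = km`, `θ_{k,km}` is the unique upper triangular diagram
in its `σ`-orbit; in particular it is minimal upper triangular. -/
theorem theta_unique_upper_in_orbit (k m : ℕ) (hk : 1 ≤ k) (hm : 1 ≤ m) :
    (∀ t : ℕ, IsUpper k (k * m) ((cyc k (k * m))^[t] (theta k m)) →
      (cyc k (k * m))^[t] (theta k m) = theta k m) ∧
    IsMinUpper k (k * m) (theta k m) := by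
  have unique : ∀ t : ℕ, IsUpper k (k * m) ((cyc k (k * m))^[t] (theta k m)) →
      (cyc k (k * m))^[t] (theta k m) = theta k m := fun t ht => by
    obtain ⟨c, -, h⟩ := iterate_cyc_theta hk hm t
    rw [h] at ht ⊢
    obtain rfl : c = 0 := (Nat.add_eq_zero_iff.mp (ht.last_eq_zero hk)).2
    rfl
  exact ⟨unique, isUpper_theta k m, fun t ht => Or.inl (unique t ht).symm⟩
end
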